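/- For an invertible operator D and bounded operator a, for every natural number k and integer ℓ one has [D, a]^{(k)} D^{-ℓ} = D^{2k+1-ℓ} Σ^{(k,ℓ)}(a), where [D,a]^{(k)} denotes the k-th iterated commutator of [D,a] with D^2 (i.e. P^{(k)} = ∇^k(P) with ∇(T) = [D^2, T]), α^m(a) = D^m a D^{-m}, and Σ^{(k,ℓ)}(a) = Σ_{j=0}^{k} (-1)^j C(k,j) (α^{ℓ-2j}(a) - α^{ℓ-2j-1}(a)). -/

import Mathlib

/-- Integer powers of an invertible bounded operator. -/
def zpD {H : Type*} [NormedAddCommGroup H] [InnerProductSpace ℂ H] [CompleteSpace H]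
    (D : (H →L[ℂ] H)ˣ) (n : ℤ) : H →L[ℂ] H :=
  ((D ^ n : (H →L[ℂ] H)ˣ) : H →L[ℂ] H)

/-- `∇(T) = [D², T]`. -/
def nablaD {H : Type*} [NormedAddCommGroup H] [InnerProductSpace ℂ H] [CompleteSpace H]
    (D : (H →L[ℂ] H)ˣ) (T : H →L[ℂ] H) : H →L[ℂ] H :=
  zpD D 2 * T - T * zpD D 2

/-- `α^m(a) = D^m a D^{-m}`. -/
def alphaD {H : Type*} [NormedAddCommGroup H] [InnerProductSpace ℂ H] [CompleteSpace H]
    (D : (H →L[ℂ] H)ˣ) (m : ℤ) (a : H →L[ℂ] H) : H →L[ℂ] H :=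
  zpD D m * a * zpD D (-m)

/-- `Σ^{(k,ℓ)}(a) = Σ_{j=0}^{k} (-1)^j C(k,j) (α^{ℓ-2j}(a) - α^{ℓ-2j-1}(a))`. -/
noncomputable def SigmaKL {H : Type*} [NormedAddCommGroup H] [InnerProductSpace ℂ H] [CompleteSpace H]
    (D : (H →L[ℂ] H)ˣ) (k : ℕ) (l : ℤ) (a : H →L[ℂ] H) : H →L[ℂ] H :=
  ∑ j ∈ Finset.range (k + 1),
    ((-1 : ℤ) ^ j * (k.choose j : ℤ)) •
      (alphaD D (l - 2 * j) a - alphaD D (l - 2 * j - 1) a)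

theorem aux_pascal {M : Type*} [AddCommGroup M] (f : ℕ → M) (k : ℕ) :
    ∑ j ∈ Finset.range (k + 1 + 1), ((-1 : ℤ) ^ j * ((k + 1).choose j : ℤ)) • f j =
      ∑ j ∈ Finset.range (k + 1), ((-1 : ℤ) ^ j * (k.choose j : ℤ)) • f j -
      ∑ j ∈ Finset.range (k + 1), ((-1 : ℤ) ^ j * (k.choose j : ℤ)) • f (j + 1) := by
  have h1 : ∑ j ∈ Finset.range (k + 1), ((-1 : ℤ) ^ j * (k.choose j : ℤ)) • f j =
      ∑ j ∈ Finset.range (k + 1 + 1), ((-1 : ℤ) ^ j * (k.choose j : ℤ)) • f j := by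
    rw [Finset.sum_range_succ _ (k + 1)]
    simp
  rw [h1, Finset.sum_range_succ' _ (k + 1), Finset.sum_range_succ' _ (k + 1),
    add_sub_right_comm, ← Finset.sum_sub_distrib]
  congr 1
  · refine Finset.sum_congr rfl fun j _ => ?_
    rw [← sub_smul, Nat.choose_succ_succ]
    congr 1
    push_cast
    ring
  · simp

theorem aux_zpD_mul {H : Type*} [NormedAddCommGroup H] [InnerProductSpace ℂ H] [CompleteSpace H]
    (D : (H →L[ℂ] H)ˣ) (m n : ℤ) : zpD D m * zpD D n = zpD D (m + n) := by
  simp only [zpD, zpow_add, Units.val_mul]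

theorem aux_Sigma {H : Type*} [NormedAddCommGroup H] [InnerProductSpace ℂ H] [CompleteSpace H]
    (D : (H →L[ℂ] H)ˣ) (k : ℕ) (l : ℤ) (a : H →L[ℂ] H) :
    SigmaKL D (k + 1) l a = SigmaKL D k l a - SigmaKL D k (l - 2) a := by
  unfold SigmaKL
  rw [aux_pascal (fun j : ℕ => alphaD D (l - 2 * j) a - alphaD D (l - 2 * j - 1) a) k]
  congr 1
  refine Finset.sum_congr rfl fun j _ => ?_
  have : l - 2 * ((j + 1 : ℕ) : ℤ) = l - 2 - 2 * j := by push_cast; ring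
  simp only [this]

/-- For an invertible operator `D` and bounded operator `a`, for every natural
number `k` and integer `ℓ` one has `[D, a]^{(k)} D^{-ℓ} = D^{2k+1-ℓ} Σ^{(k,ℓ)}(a)`, where
`[D,a]^{(k)} = ∇^k([D,a])` with `∇(T) = [D², T]`. -/
theorem stmt6 {H : Type*} [NormedAddCommGroup H] [InnerProductSpace ℂ H] [CompleteSpace H]
    (D : (H →L[ℂ] H)ˣ) (a : H →L[ℂ] H) (k : ℕ) (l : ℤ) :
    (nablaD D)^[k] ((D : H →L[ℂ] H) * a - a * (D : H →L[ℂ] H)) * zpD D (-l) =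
      zpD D (2 * (k : ℤ) + 1 - l) * SigmaKL D k l a := by
  induction k generalizing l with
  | zero =>
    have h0 : zpD D 0 = 1 := by simp [zpD]
    have h1 : (D : H →L[ℂ] H) = zpD D 1 := by simp [zpD]
    have hS : SigmaKL D 0 l a = zpD D l * a * zpD D (-l) -
        zpD D (l - 1) * a * zpD D (-(l - 1)) := by
      simp [SigmaKL, alphaD]
    rw [hS, h1, Function.iterate_zero, id, sub_mul, mul_sub, mul_assoc a, aux_zpD_mul,
      ← mul_assoc, ← mul_assoc, ← mul_assoc, ← mul_assoc, aux_zpD_mul, aux_zpD_mul,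
      show 2 * ((0 : ℕ) : ℤ) + 1 - l + l = 1 by simp,
      show 2 * ((0 : ℕ) : ℤ) + 1 - l + (l - 1) = 0 by simp, h0, one_mul,
      show -(l - 1) = 1 + -l by ring]
  | succ k ih =>
    rw [Function.iterate_succ_apply', aux_Sigma, mul_sub, nablaD, sub_mul, mul_assoc, ih,
      mul_assoc _ (zpD D 2), aux_zpD_mul, show (2 : ℤ) + -l = -(l - 2) by ring, ih,
      ← mul_assoc, aux_zpD_mul]
    congr 3 <;> push_cast <;> ring
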